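/- Let n ≥ 1 and let u be a non-constant solution of the Allen–Cahn equation −Δu = u − u³ on ℝⁿ with u(x) < 0 for every x with xₙ < 0. Then u(x) → −1 as xₙ → −∞ uniformly in the other variables: for every ε > 0 there exists R > 0 such that every x ∈ ℝⁿ with xₙ ≤ −R satisfies |u(x) + 1| ≤ ε. -/

import Mathlib

open scoped RealInnerProductSpace

noncomputable def laplacian {n : ℕ} (u : EuclideanSpace ℝ (Fin n) → ℝ)
    (x : EuclideanSpace ℝ (Fin n)) : ℝ :=
  ∑ i : Fin n, fderiv ℝ (fun y => fderiv ℝ u y (EuclideanSpace.single i 1)) x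
    (EuclideanSpace.single i 1)

def IsACSolution {n : ℕ} (u : EuclideanSpace ℝ (Fin n) → ℝ) : Prop :=
  ContDiff ℝ 2 u ∧ ∀ x, -laplacian u x = u x - (u x) ^ 3

noncomputable def H (t : ℝ) : ℝ := Real.tanh (t / Real.sqrt 2)

open Filter Topology

theorem second_deriv_nonneg {h h' : ℝ → ℝ} {c : ℝ} (h1 : ∀ s, HasDerivAt h (h' s) s)
    (h2 : HasDerivAt h' c 0) (hm : IsLocalMin h 0) : 0 ≤ c := by
  by_contra hc
  push Not at hc
  have hd : deriv h = h' := funext fun s => (h1 s).deriv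
  have hM : IsLocalMax h 0 := by
    apply isLocalMax_of_deriv_deriv_neg
    · rw [hd, h2.deriv]; exact hc
    · exact hm.deriv_eq_zero
    · exact (h1 0).continuousAt
  have hconst : h =ᶠ[𝓝 0] fun _ => h 0 := by
    filter_upwards [hm, hM] with s a b
    exact le_antisymm b a
  have hd0 : deriv h =ᶠ[𝓝 0] fun _ => 0 := by
    have := hconst.deriv
    simpa using this
  have : deriv (deriv h) 0 = 0 := by
    rw [hd0.deriv_eq]; simp
  rw [hd, h2.deriv] at this
  linarith

section
variable {n : ℕ}

theorem line_deriv1 {v : EuclideanSpace ℝ (Fin n) → ℝ} (hv : ContDiff ℝ 2 v)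
    (x e : EuclideanSpace ℝ (Fin n)) (s : ℝ) :
    HasDerivAt (fun s : ℝ => v (x + s • e)) (fderiv ℝ v (x + s • e) e) s := by
  have hl : HasDerivAt (fun s : ℝ => x + s • e) e s := by
    simpa using ((hasDerivAt_id s).smul_const e).const_add x
  exact ((hv.differentiable (by norm_num)) (x + s • e)).hasFDerivAt.comp_hasDerivAt s hl

theorem line_deriv2 {v : EuclideanSpace ℝ (Fin n) → ℝ} (hv : ContDiff ℝ 2 v)
    (x e : EuclideanSpace ℝ (Fin n)) :
    HasDerivAt (fun s : ℝ => fderiv ℝ v (x + s • e) e)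
      (fderiv ℝ (fun y => fderiv ℝ v y e) x e) 0 := by
  have hl : HasDerivAt (fun s : ℝ => x + s • e) e 0 := by
    simpa using ((hasDerivAt_id (0:ℝ)).smul_const e).const_add x
  have hd : Differentiable ℝ (fun y => fderiv ℝ v y e) := by
    have : ContDiff ℝ 1 (fderiv ℝ v) := hv.fderiv_right (by norm_num)
    exact (this.differentiable (by norm_num)).clm_apply (differentiable_const e)
  have h0 := (hd (x + (0:ℝ) • e)).hasFDerivAt.comp_hasDerivAt (0:ℝ) hl
  exact HasDerivAt.congr_deriv h0 (by simp)

/-- The quadratic bump. -/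
noncomputable def bump (x0 : EuclideanSpace ℝ (Fin n)) (R : ℝ) (x : EuclideanSpace ℝ (Fin n)) : ℝ :=
  1 - ‖x - x0‖ ^ 2 / R ^ 2

theorem bump_line (x0 x : EuclideanSpace ℝ (Fin n)) (R : ℝ) (i : Fin n) (s : ℝ) :
    bump x0 R (x + s • EuclideanSpace.single i (1:ℝ)) =
      bump x0 R x - (2 * (x i - x0 i) * s + s ^ 2) / R ^ 2 := by
  have : x + s • EuclideanSpace.single i (1:ℝ) - x0 =
    (x - x0) + s • EuclideanSpace.single i (1:ℝ) := by abel
  unfold bump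
  rw [this, norm_add_sq_real, inner_smul_right, norm_smul]
  simp [EuclideanSpace.inner_single_right]
  ring

theorem bump_cont (x0 : EuclideanSpace ℝ (Fin n)) (R : ℝ) : Continuous (bump x0 R) := by
  unfold bump; fun_prop

theorem sum_sq (x0 x : EuclideanSpace ℝ (Fin n)) {R : ℝ} (hR : 0 < R) :
    ∑ i, (x i - x0 i) ^ 2 = R ^ 2 * (1 - bump x0 R x) := by
  unfold bump
  rw [EuclideanSpace.norm_sq_eq]
  simp
  field_simp

theorem bump_nonneg {x0 x : EuclideanSpace ℝ (Fin n)} {R : ℝ} (hR : 0 < R)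
    (hx : x ∈ Metric.closedBall x0 R) : 0 ≤ bump x0 R x := by
  rw [mem_closedBall_iff_norm] at hx
  unfold bump
  rw [sub_nonneg, div_le_one (by positivity)]
  gcongr

theorem ball_of_bump_pos {x0 x : EuclideanSpace ℝ (Fin n)} {R : ℝ} (hR : 0 < R)
    (hx : 0 < bump x0 R x) : x ∈ Metric.ball x0 R := by
  rw [mem_ball_iff_norm]
  unfold bump at hx
  rw [sub_pos, div_lt_one (by positivity)] at hx
  exact lt_of_pow_lt_pow_left₀ 2 hR.le hx

theorem bump_le_one (x0 x : EuclideanSpace ℝ (Fin n)) (R : ℝ) : bump x0 R x ≤ 1 := by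
  unfold bump
  have : 0 ≤ ‖x - x0‖ ^ 2 / R ^ 2 := by positivity
  linarith

theorem bump_center (x0 : EuclideanSpace ℝ (Fin n)) (R : ℝ) : bump x0 R x0 = 1 := by
  simp [bump]

theorem line_tendsto (x e : EuclideanSpace ℝ (Fin n)) :
    Tendsto (fun s : ℝ => x + s • e) (𝓝 0) (𝓝 x) := by
  have : Continuous (fun s : ℝ => x + s • e) := by fun_prop
  simpa using this.tendsto 0

theorem bump_d1 (b y R s : ℝ) :
    HasDerivAt (fun s : ℝ => b - (2 * y * s + s ^ 2) / R ^ 2) (-(2 * y + 2 * s) / R ^ 2) s := by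
  have h1 : HasDerivAt (fun s : ℝ => 2 * y * s + s ^ 2) (2 * y + 2 * s) s := by
    have := ((hasDerivAt_id s).const_mul (2 * y)).add ((hasDerivAt_id s).pow 2)
    exact HasDerivAt.congr_deriv this (by simp)
  exact HasDerivAt.congr_deriv ((h1.div_const (R ^ 2)).const_sub b) (by ring)

theorem bump_d2 (y R : ℝ) :
    HasDerivAt (fun s : ℝ => -(2 * y + 2 * s) / R ^ 2) (-2 / R ^ 2) 0 := by
  have h1 : HasDerivAt (fun s : ℝ => -(2 * y + 2 * s)) (-2) 0 := by
    have := (((hasDerivAt_id (0:ℝ)).const_mul (2:ℝ)).const_add (2 * y)).neg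
    exact HasDerivAt.congr_deriv this (by simp)
  exact h1.div_const _

theorem lower {v : EuclideanSpace ℝ (Fin n) → ℝ} (hv : ContDiff ℝ 2 v)
    (hL : ∀ x, laplacian v x = v x ^ 3 - v x) (x0 : EuclideanSpace ℝ (Fin n)) {R a : ℝ}
    (hR : 0 < R) (ha : 0 < a)
    (hpos : ∀ x ∈ Metric.closedBall x0 R, 0 < v x)
    (hbig : (4 * n + 8 : ℝ) ^ 2 < 32 * (1 - a ^ 2) * R ^ 2) : a ≤ v x0 := by
  by_contra hlt
  push Not at hlt
  have hc0 : x0 ∈ Metric.closedBall x0 R := Metric.mem_closedBall_self hR.le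
  obtain ⟨x1, hx1, hmax⟩ := (isCompact_closedBall x0 R).exists_isMaxOn ⟨x0, hc0⟩
    (f := fun x => bump x0 R x ^ 2 / v x)
    (((bump_cont x0 R).pow 2).continuousOn.div hv.continuous.continuousOn
      (fun x hx => (hpos x hx).ne'))
  have hv1 := hpos x1 hx1
  have hv0 := hpos x0 hc0
  set m := bump x0 R x1 ^ 2 / v x1 with hm
  have hm0 : 1 / v x0 ≤ m := by
    have := hmax hc0
    simpa [bump_center] using this
  have hmpos : 0 < m := lt_of_lt_of_le (by positivity) hm0
  obtain ⟨k, hk⟩ : ∃ k, k = 1 / m := ⟨_, rfl⟩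
  have hkpos : 0 < k := by rw [hk]; positivity
  have hka : k < a := by
    refine lt_of_le_of_lt ?_ hlt
    rw [hk]
    rw [div_le_iff₀ hmpos]
    rw [div_le_iff₀ hv0] at hm0
    linarith
  have hkm : k * m = 1 := by rw [hk]; field_simp
  have hle : ∀ x ∈ Metric.closedBall x0 R, k * bump x0 R x ^ 2 ≤ v x := by
    intro x hx
    have h1 : bump x0 R x ^ 2 / v x ≤ m := hmax hx
    rw [div_le_iff₀ (hpos x hx)] at h1
    calc k * bump x0 R x ^ 2 ≤ k * (m * v x) := by gcongr
      _ = v x := by rw [← mul_assoc, hkm, one_mul]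
  have heq : k * bump x0 R x1 ^ 2 = v x1 := by
    have : bump x0 R x1 ^ 2 = m * v x1 := by rw [hm]; field_simp
    rw [this, ← mul_assoc, hkm, one_mul]
  have htpos : 0 < bump x0 R x1 := by
    rcases (bump_nonneg hR hx1).lt_or_eq with h | h
    · exact h
    · rw [← h] at heq; simp at heq; linarith
  have hball := ball_of_bump_pos hR htpos
  have hnear : ∀ᶠ x in 𝓝 x1, x ∈ Metric.ball x0 R := Metric.isOpen_ball.mem_nhds hball
  obtain ⟨t, ht⟩ : ∃ t, t = bump x0 R x1 := ⟨_, rfl⟩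
  have key : ∀ i : Fin n, k * (8 * (x1 i - x0 i) ^ 2 / R ^ 4 - 4 * t / R ^ 2) ≤
      fderiv ℝ (fun y => fderiv ℝ v y (EuclideanSpace.single i 1)) x1
        (EuclideanSpace.single i 1) := by
    intro i
    have hd1 : ∀ s, HasDerivAt (fun s : ℝ => v (x1 + s • EuclideanSpace.single i (1:ℝ)) -
        k * (t - (2 * (x1 i - x0 i) * s + s ^ 2) / R ^ 2) ^ 2)
        (fderiv ℝ v (x1 + s • EuclideanSpace.single i (1:ℝ)) (EuclideanSpace.single i (1:ℝ)) -
        k * (2 * (t - (2 * (x1 i - x0 i) * s + s ^ 2) / R ^ 2) *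
          (-(2 * (x1 i - x0 i) + 2 * s) / R ^ 2))) s := by
      intro s
      have := (line_deriv1 hv x1 (EuclideanSpace.single i (1:ℝ)) s).sub
        (((bump_d1 t (x1 i - x0 i) R s).pow 2).const_mul k)
      exact HasDerivAt.congr_deriv this (by simp)
    have hd2 := (line_deriv2 hv x1 (EuclideanSpace.single i (1:ℝ))).sub
      ((((bump_d1 t (x1 i - x0 i) R 0).const_mul 2).mul (bump_d2 (x1 i - x0 i) R)).const_mul k)
    have hmin : IsLocalMin (fun s : ℝ => v (x1 + s • EuclideanSpace.single i (1:ℝ)) -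
        k * (t - (2 * (x1 i - x0 i) * s + s ^ 2) / R ^ 2) ^ 2) 0 := by
      have := (line_tendsto x1 (EuclideanSpace.single i (1:ℝ))).eventually hnear
      filter_upwards [this] with s hs
      have h1 := hle _ (Metric.ball_subset_closedBall hs)
      rw [bump_line, ← ht] at h1
      have h2 : v x1 = k * t ^ 2 := by rw [ht, heq]
      simp [h2]
      linarith
    have := second_deriv_nonneg hd1 hd2 hmin
    have e : k * (8 * (x1 i - x0 i) ^ 2 / R ^ 4 - 4 * t / R ^ 2) =
      k * (2 * (-(2 * (x1 i - x0 i) + 2 * 0) / R ^ 2) * (-(2 * (x1 i - x0 i) + 2 * 0) / R ^ 2) +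
        2 * (t - (2 * (x1 i - x0 i) * 0 + 0 ^ 2) / R ^ 2) * (-2 / R ^ 2)) := by
      field_simp
      ring
    rw [e]
    linarith
  have hsum := Finset.sum_le_sum (fun i (_ : i ∈ Finset.univ) => key i)
  change _ ≤ laplacian v x1 at hsum
  rw [hL, ← Finset.mul_sum, Finset.sum_sub_distrib, ← Finset.sum_div, ← Finset.mul_sum,
    sum_sq x0 x1 hR, ← heq, ← ht] at hsum
  simp at hsum
  have ht1 : t ≤ 1 := ht ▸ bump_le_one x0 x1 R
  rw [← ht] at htpos
  have h3 : 8 * (1 - t) - 4 * n * t ≤ R ^ 2 * (k ^ 2 * t ^ 6 - t ^ 2) := by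
    have e1 : k * (8 * (R ^ 2 * (1 - t)) / R ^ 4 - n * (4 * t / R ^ 2)) =
      (k / R ^ 2) * (8 * (1 - t) - 4 * n * t) := by field_simp
    have e2 : (k * t ^ 2) ^ 3 - k * t ^ 2 = (k / R ^ 2) * (R ^ 2 * (k ^ 2 * t ^ 6 - t ^ 2)) := by
      field_simp
    rw [e1, e2] at hsum
    exact le_of_mul_le_mul_left hsum (by positivity)
  have h4 : k ^ 2 * t ^ 6 ≤ a ^ 2 * t ^ 2 := by
    have : t ^ 6 ≤ t ^ 2 := pow_le_pow_of_le_one htpos.le ht1 (by norm_num)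
    gcongr
  have h5 : 8 * (1 - t) - 4 * n * t ≤ R ^ 2 * (a ^ 2 * t ^ 2 - t ^ 2) :=
    h3.trans (by gcongr)
  nlinarith [sq_nonneg ((4 * n + 8) * t - 16), mul_lt_mul_of_pos_right hbig (pow_pos htpos 2)]

theorem upper {v : EuclideanSpace ℝ (Fin n) → ℝ} (hv : ContDiff ℝ 2 v)
    (hL : ∀ x, laplacian v x = v x ^ 3 - v x) (x0 : EuclideanSpace ℝ (Fin n)) {R b : ℝ}
    (hR : 0 < R) (hb : 1 < b)
    (hbig : (2 * n + 8 : ℝ) < (b ^ 2 - 1) * R ^ 2) : v x0 ≤ b := by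
  by_contra hlt
  push Not at hlt
  have hc0 : x0 ∈ Metric.closedBall x0 R := Metric.mem_closedBall_self hR.le
  obtain ⟨x1, hx1, hmax⟩ := (isCompact_closedBall x0 R).exists_isMaxOn ⟨x0, hc0⟩
    (f := fun x => v x * bump x0 R x)
    (hv.continuous.mul (bump_cont x0 R)).continuousOn
  obtain ⟨m, hm⟩ : ∃ m, m = v x1 * bump x0 R x1 := ⟨_, rfl⟩
  have hm0 : v x0 ≤ m := by
    have := hmax hc0
    simpa [bump_center, hm] using this
  have hbm : b < m := hlt.trans_le hm0
  have htpos : 0 < bump x0 R x1 := by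
    rcases (bump_nonneg hR hx1).lt_or_eq with h | h
    · exact h
    · rw [← h] at hm; simp at hm; linarith
  have hball := ball_of_bump_pos hR htpos
  have hnear : ∀ᶠ x in 𝓝 x1, x ∈ Metric.ball x0 R := Metric.isOpen_ball.mem_nhds hball
  have ht1 := bump_le_one x0 x1 R
  obtain ⟨t, ht⟩ : ∃ t, t = bump x0 R x1 := ⟨_, rfl⟩
  rw [← ht] at htpos ht1 hm
  have hvm : v x1 = m / t := by rw [hm]; field_simp
  have key : ∀ i : Fin n, 
      fderiv ℝ (fun y => fderiv ℝ v y (EuclideanSpace.single i 1)) x1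
        (EuclideanSpace.single i 1) ≤
        m * (8 * (x1 i - x0 i) ^ 2 / (R ^ 4 * t ^ 3) + 2 / (R ^ 2 * t ^ 2)) := by
    intro i
    set y := x1 i - x0 i with hy
    have hd1 : ∀ s, HasDerivAt (fun s : ℝ => -(v (x1 + s • EuclideanSpace.single i (1:ℝ)) *
        (t - (2 * y * s + s ^ 2) / R ^ 2)))
        (-(fderiv ℝ v (x1 + s • EuclideanSpace.single i (1:ℝ)) (EuclideanSpace.single i (1:ℝ)) *
        (t - (2 * y * s + s ^ 2) / R ^ 2) + v (x1 + s • EuclideanSpace.single i (1:ℝ)) *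
          (-(2 * y + 2 * s) / R ^ 2))) s := by
      intro s
      exact ((line_deriv1 hv x1 (EuclideanSpace.single i (1:ℝ)) s).mul
        (bump_d1 t y R s)).neg
    have hd2 := (((line_deriv2 hv x1 (EuclideanSpace.single i (1:ℝ))).mul
      (bump_d1 t y R 0)).add ((line_deriv1 hv x1 (EuclideanSpace.single i (1:ℝ)) 0).mul
        (bump_d2 y R))).neg
    have hmin : IsLocalMin (fun s : ℝ => -(v (x1 + s • EuclideanSpace.single i (1:ℝ)) *
        (t - (2 * y * s + s ^ 2) / R ^ 2))) 0 := by
      have := (line_tendsto x1 (EuclideanSpace.single i (1:ℝ))).eventually hnear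
      filter_upwards [this] with s hs
      have h1 := hmax (Metric.ball_subset_closedBall hs)
      simp only [Set.mem_ofPred_eq, bump_line, ← ht, ← hy] at h1
      simpa using h1
    have h1 := hmin.hasDerivAt_eq_zero (hd1 0)
    have h2 := second_deriv_nonneg hd1 hd2 hmin
    simp only [zero_smul, add_zero, hvm] at h1 h2
    generalize (fderiv ℝ v x1) (EuclideanSpace.single i (1:ℝ)) = p at h1 h2
    generalize fderiv ℝ (fun y => fderiv ℝ v y (EuclideanSpace.single i 1)) x1
        (EuclideanSpace.single i 1) = q at h2 ⊢
    have hp : p = 2 * m * y / (R ^ 2 * t ^ 2) := by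
      field_simp at h1 ⊢
      ring_nf at h1 ⊢
      linarith
    rw [hp] at h2
    have h3 : 0 ≤ t * (m * (8 * y ^ 2 / (R ^ 4 * t ^ 3) + 2 / (R ^ 2 * t ^ 2)) - q) := by
      convert h2 using 1
      field_simp
      ring
    have := nonneg_of_mul_nonneg_right h3 htpos
    linarith
  have hsum := Finset.sum_le_sum (fun i (_ : i ∈ Finset.univ) => key i)
  change laplacian v x1 ≤ _ at hsum
  rw [hL, ← Finset.mul_sum, Finset.sum_add_distrib, ← Finset.sum_div, ← Finset.mul_sum,
    sum_sq x0 x1 hR, ← ht, hvm] at hsum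
  simp at hsum
  have hmpos : 0 < m := by linarith
  have h3 : R ^ 2 * (m ^ 2 - t ^ 2) ≤ 8 * (1 - t) + 2 * n * t := by
    have e1 : m * (8 * (R ^ 2 * (1 - t)) / (R ^ 4 * t ^ 3) + n * (2 / (R ^ 2 * t ^ 2))) =
      (m / (R ^ 2 * t ^ 3)) * (8 * (1 - t) + 2 * n * t) := by field_simp
    have e2 : (m / t) ^ 3 - m / t = (m / (R ^ 2 * t ^ 3)) * (R ^ 2 * (m ^ 2 - t ^ 2)) := by
      field_simp
    rw [e1, ← sub_le_iff_le_add, e2] at hsum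
    exact le_of_mul_le_mul_left hsum (by positivity)
  have h4 : (b ^ 2 - 1) * R ^ 2 ≤ R ^ 2 * (m ^ 2 - t ^ 2) := by
    rw [mul_comm]
    have : b ^ 2 ≤ m ^ 2 := by gcongr
    have : t ^ 2 ≤ 1 := pow_le_one₀ htpos.le ht1
    gcongr
  have hn : (n : ℝ) * t ≤ n := mul_le_of_le_one_right (by positivity) ht1
  nlinarith

theorem laplacian_neg' (u : EuclideanSpace ℝ (Fin n) → ℝ) (x : EuclideanSpace ℝ (Fin n)) :
    laplacian (fun y => - u y) x = - laplacian u x := by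
  unfold laplacian
  simp [fderiv_fun_neg]

end

theorem uniform_limit_minus_one {n : ℕ} (hn1 : 1 ≤ n)
    (u : EuclideanSpace ℝ (Fin n) → ℝ)
    (hu : IsACSolution u) (hnc : ¬ ∃ c : ℝ, ∀ x, u x = c)
    (hneg : ∀ x : EuclideanSpace ℝ (Fin n), x ⟨n - 1, by omega⟩ < 0 → u x < 0) :
    ∀ ε : ℝ, 0 < ε → ∃ R : ℝ, 0 < R ∧
      ∀ x : EuclideanSpace ℝ (Fin n), x ⟨n - 1, by omega⟩ ≤ -R → |u x + 1| ≤ ε := by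
  intro ε hε
  have hv : ContDiff ℝ 2 (fun y => - u y) := hu.1.neg
  have hL : ∀ x, laplacian (fun y => - u y) x = (fun y => - u y) x ^ 3 - (fun y => - u y) x := by
    intro x
    rw [laplacian_neg', hu.2 x]
    ring
  obtain ⟨δ, hδ0, hδ1, hδε⟩ : ∃ δ : ℝ, 0 < δ ∧ δ < 1 ∧ δ ≤ ε :=
    ⟨min ε (1 / 2), by positivity, (min_le_right _ _).trans_lt (by norm_num), min_le_left _ _⟩
  have hev : ∀ c C : ℝ, 0 < c → ∀ᶠ R : ℝ in atTop, C < c * R ^ 2 := by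
    intro c C hc
    exact ((tendsto_pow_atTop (by norm_num)).const_mul_atTop hc).eventually_gt_atTop C
  have hc1 : 0 < 32 * (1 - (1 - δ) ^ 2) := by nlinarith
  have hc2 : 0 < (1 + δ) ^ 2 - 1 := by nlinarith
  obtain ⟨r, h1, h2, h3⟩ := ((hev _ ((4 * n + 8 : ℝ) ^ 2) hc1).and
    ((hev _ (2 * n + 8 : ℝ) hc2).and (eventually_gt_atTop (0:ℝ)))).exists
  refine ⟨r + 1, by linarith, fun x hx => ?_⟩
  have hlo := lower hv hL x h3 (a := 1 - δ) (by linarith) (by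
    intro y hy
    have : y ⟨n - 1, by omega⟩ < 0 := by
      rw [mem_closedBall_iff_norm] at hy
      have h4 := (PiLp.norm_apply_le (y - x) ⟨n - 1, by omega⟩).trans hy
      rw [Real.norm_eq_abs, PiLp.sub_apply] at h4
      have := (abs_le.1 h4).2
      linarith
    have := hneg y this
    linarith) h1
  have hup := upper hv hL x h3 (b := 1 + δ) (by linarith) h2
  rw [abs_le]
  constructor <;> linarith
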